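/- arXiv:1708.01700 — 3 statements merged into one kernel-verified Lean document; each statement's English description precedes it below -/
import Mathlib

section
/- For every integer n ≥ 2, there exists a proper colouring of the Mycielskian μ(P_n) of the path P_n using the three colours 1, 2, 3 (three being the chromatic number of μ(P_n)) whose colouring mean equals (7n+3)/(4n+2) when n is odd and (7n+4)/(4n+2) when n is even, and whose colouring variance equals (11n²−3)/(4n+2)² when n is odd and (11n²+6n)/(4n+2)² when n is even. -/
open Finset

/-- The Mycielskian of a graph `G` on vertex set `V`: vertices are
`V ⊕ V ⊕ Unit` where `Sum.inl a` is the original vertex `v_a`,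
`Sum.inr (Sum.inl a)` is the shadow vertex `u_a`, and `Sum.inr (Sum.inr ())`
is the apex vertex `u`. -/
def mycielskian {V : Type*} (G : SimpleGraph V) : SimpleGraph (V ⊕ V ⊕ Unit) :=
  SimpleGraph.fromRel (fun x y =>
    match x, y with
    | Sum.inl a, Sum.inl b => G.Adj a b
    | Sum.inl a, Sum.inr (Sum.inl b) => G.Adj a b
    | Sum.inr (Sum.inl _), Sum.inr (Sum.inr _) => True
    | _, _ => False)

/-- `colClass c i` is the number of vertices receiving colour `i`. -/
def colClass {V : Type*} [Fintype V] (c : V → ℕ) (i : ℕ) : ℕ :=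
  (Finset.univ.filter (fun v => c v = i)).card

/-- The colouring mean of a colouring `c` using colours `1, …, k`. -/
def colMean {V : Type*} [Fintype V] (c : V → ℕ) (k : ℕ) : ℚ :=
  (∑ i ∈ Finset.Icc 1 k, (i : ℚ) * (colClass c i)) / (Fintype.card V : ℚ)

/-- The colouring variance of a colouring `c` using colours `1, …, k`. -/
def colVar {V : Type*} [Fintype V] (c : V → ℕ) (k : ℕ) : ℚ :=
  (∑ i ∈ Finset.Icc 1 k, (i : ℚ) ^ 2 * (colClass c i)) / (Fintype.card V : ℚ)
    - (colMean c k) ^ 2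

/-- The path graph `P_n` on `Fin n`. -/
def pathG (n : ℕ) : SimpleGraph (Fin n) :=
  SimpleGraph.fromRel (fun i j => (i : ℕ) + 1 = (j : ℕ))

/-- The colouring of the Mycielskian of `P_n` giving the path the colours `2, 3, 2, 3, …`,
the shadow vertices the colour `1` and the apex the colour `2`. -/
def mycielskianPathColouring (n : ℕ) : Fin n ⊕ Fin n ⊕ Unit → ℕ
  | Sum.inl i => (i : ℕ) % 2 + 2
  | Sum.inr (Sum.inl _) => 1
  | Sum.inr (Sum.inr _) => 2

theorem mycielskianPathColouring_mem_Icc (n : ℕ) (v : Fin n ⊕ Fin n ⊕ Unit) :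
    mycielskianPathColouring n v ∈ Finset.Icc 1 3 := by
  rcases v with i | i | u <;> simp only [mycielskianPathColouring, Finset.mem_Icc] <;> omega

theorem mycielskianPathColouring_ne_of_adj {n : ℕ} {x y : Fin n ⊕ Fin n ⊕ Unit}
    (h : (mycielskian (pathG n)).Adj x y) :
    mycielskianPathColouring n x ≠ mycielskianPathColouring n y := by
  rcases x with i | i | u <;> rcases y with j | j | w <;>
    simp [mycielskian, pathG, mycielskianPathColouring] at h ⊢
  omega

/-- Summing a weight over the colour classes is summing it over the vertices. -/
theorem sum_mul_colClass {V : Type*} [Fintype V] (c : V → ℕ) (k : ℕ)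
    (hc : ∀ v, c v ∈ Finset.Icc 1 k) (f : ℕ → ℚ) :
    ∑ i ∈ Finset.Icc 1 k, f i * colClass c i = ∑ v, f (c v) := by
  rw [← Finset.sum_fiberwise_of_maps_to' (t := Finset.Icc 1 k) (fun v _ => hc v) f]
  refine Finset.sum_congr rfl fun i _ => ?_
  rw [Finset.sum_const, nsmul_eq_mul, mul_comm, colClass]

theorem sum_range_two_mul_mod_two (g : ℕ → ℚ) (m : ℕ) :
    ∑ i ∈ Finset.range (2 * m), g (i % 2) = m * (g 0 + g 1) := by
  induction m with
  | zero => simp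
  | succ m ih =>
    rw [Nat.mul_succ, Finset.sum_range_succ, Finset.sum_range_succ, ih,
      Nat.mul_mod_right, Nat.mul_add_mod]
    push_cast
    ring

theorem sum_mul_colClass_mycielskianPathColouring (n : ℕ) (f : ℕ → ℚ) :
    ∑ i ∈ Finset.Icc 1 3, f i * colClass (mycielskianPathColouring n) i =
      ∑ i ∈ Finset.range n, f (i % 2 + 2) + n * f 1 + f 2 := by
  rw [sum_mul_colClass _ _ (mycielskianPathColouring_mem_Icc n),
    Finset.sum_range fun i => f (i % 2 + 2)]
  simp [mycielskianPathColouring, add_assoc]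

/-- The $χ$-chromatic mean and variance of the Mycielskian of the path $P_n$. -/
theorem chi_chromatic_parameters_mycielskian_path (n : ℕ) (hn : 2 ≤ n) :
    ∃ c : (Fin n ⊕ Fin n ⊕ Unit) → ℕ,
      (∀ v, c v ∈ Finset.Icc 1 3) ∧
      (∀ x y, (mycielskian (pathG n)).Adj x y → c x ≠ c y) ∧
      (Odd n →
        colMean c 3 = (7 * (n : ℚ) + 3) / (4 * (n : ℚ) + 2) ∧
        colVar c 3 = (11 * (n : ℚ) ^ 2 - 3) / (4 * (n : ℚ) + 2) ^ 2) ∧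
      (Even n →
        colMean c 3 = (7 * (n : ℚ) + 4) / (4 * (n : ℚ) + 2) ∧
        colVar c 3 = (11 * (n : ℚ) ^ 2 + 6 * (n : ℚ)) / (4 * (n : ℚ) + 2) ^ 2) := by
  have card : (Fintype.card (Fin n ⊕ Fin n ⊕ Unit) : ℚ) = 2 * n + 1 := by
    simp
    ring
  have mean := sum_mul_colClass_mycielskianPathColouring n fun i => (i : ℚ)
  have square := sum_mul_colClass_mycielskianPathColouring n fun i => (i : ℚ) ^ 2
  have evenMean := sum_range_two_mul_mod_two fun i => ((i + 2 : ℕ) : ℚ)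
  have evenSquare := sum_range_two_mul_mod_two fun i => ((i + 2 : ℕ) : ℚ) ^ 2
  refine ⟨mycielskianPathColouring n, mycielskianPathColouring_mem_Icc n,
    fun x y => mycielskianPathColouring_ne_of_adj, ?_, ?_⟩
  · rintro ⟨m, rfl⟩
    rw [Finset.sum_range_succ, evenMean, Nat.mul_mod_right] at mean
    rw [Finset.sum_range_succ, evenSquare, Nat.mul_mod_right] at square
    rw [colVar, colMean, mean, square, card]
    push_cast
    constructor <;> field_simp <;> ring
  · intro h
    obtain ⟨m, rfl⟩ := h.two_dvd
    rw [evenMean] at mean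
    rw [evenSquare] at square
    rw [colVar, colMean, mean, square, card]
    push_cast
    constructor <;> field_simp <;> ring
end

section
/- For all integers a > b ≥ 1 with n = a + b, there exists a proper colouring of the Mycielskian μ(K_{a,b}) of the complete bipartite graph K_{a,b} using the three colours 1, 2, 3 whose colouring mean equals (6a+4b+1)/(2n+1) = 2 + (2a−1)/(2a+2b+1) and whose colouring variance equals (16a²+4b²+8a²b+8ab²+24ab+8a+2b)/(2n+1)³. -/
open Finset

/-- The complete bipartite graph $K_{a,b}$ on `Fin a ⊕ Fin b`. -/
def completeBipartiteG (a b : ℕ) : SimpleGraph (Fin a ⊕ Fin b) :=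
  SimpleGraph.fromRel (fun x y => x.isLeft = true ∧ y.isLeft = false)

/-- The colouring of the Mycielskian of `K_{a,b}` giving the apex colour 1, the part of size `b`
and its shadows colour 2, and the part of size `a` and its shadows colour 3. -/
def bipartiteMycielskianColouring (a b : ℕ) :
    (Fin a ⊕ Fin b) ⊕ (Fin a ⊕ Fin b) ⊕ Unit → ℕ
  | Sum.inl (Sum.inl _) => 3
  | Sum.inl (Sum.inr _) => 2
  | Sum.inr (Sum.inl (Sum.inl _)) => 3
  | Sum.inr (Sum.inl (Sum.inr _)) => 2
  | Sum.inr (Sum.inr _) => 1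

lemma bipartiteMycielskianColouring_mem_Icc (a b : ℕ)
    (v : (Fin a ⊕ Fin b) ⊕ (Fin a ⊕ Fin b) ⊕ Unit) :
    bipartiteMycielskianColouring a b v ∈ Finset.Icc 1 3 := by
  rcases v with (_ | _) | (_ | _) | _ <;> simp [bipartiteMycielskianColouring]

lemma bipartiteMycielskianColouring_proper (a b : ℕ)
    (x y : (Fin a ⊕ Fin b) ⊕ (Fin a ⊕ Fin b) ⊕ Unit)
    (h : (mycielskian (completeBipartiteG a b)).Adj x y) :
    bipartiteMycielskianColouring a b x ≠ bipartiteMycielskianColouring a b y := by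
  rcases x with (_ | _) | (_ | _) | _ <;> rcases y with (_ | _) | (_ | _) | _ <;>
    simp_all [bipartiteMycielskianColouring, mycielskian, completeBipartiteG]

lemma colClass_bipartiteMycielskianColouring (a b : ℕ) :
    colClass (bipartiteMycielskianColouring a b) 1 = 1 ∧
    colClass (bipartiteMycielskianColouring a b) 2 = 2 * b ∧
    colClass (bipartiteMycielskianColouring a b) 3 = 2 * a := by
  simp only [colClass, Finset.card_filter, Fintype.sum_sum_type]
  simp [bipartiteMycielskianColouring, two_mul]

lemma colMean_bipartiteMycielskianColouring (a b : ℕ) :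
    colMean (bipartiteMycielskianColouring a b) 3 =
      (6 * (a : ℚ) + 4 * b + 1) / (2 * a + 2 * b + 1) := by
  obtain ⟨h1, h2, h3⟩ := colClass_bipartiteMycielskianColouring a b
  simp only [colMean, Finset.sum_Icc_succ_top (show 1 ≤ 2 + 1 by norm_num),
    Finset.sum_Icc_succ_top (show 1 ≤ 1 + 1 by norm_num), Finset.Icc_self, Finset.sum_singleton,
    Nat.reduceAdd, h1, h2, h3, Fintype.card_sum, Fintype.card_fin, Fintype.card_unit]
  push_cast
  congr 1 <;> ring

lemma colVar_bipartiteMycielskianColouring (a b : ℕ) :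
    colVar (bipartiteMycielskianColouring a b) 3 =
      (18 * (a : ℚ) + 8 * b + 1) / (2 * a + 2 * b + 1) -
        ((6 * (a : ℚ) + 4 * b + 1) / (2 * a + 2 * b + 1)) ^ 2 := by
  obtain ⟨h1, h2, h3⟩ := colClass_bipartiteMycielskianColouring a b
  rw [colVar, colMean_bipartiteMycielskianColouring]
  simp only [Finset.sum_Icc_succ_top (show 1 ≤ 2 + 1 by norm_num),
    Finset.sum_Icc_succ_top (show 1 ≤ 1 + 1 by norm_num), Finset.Icc_self, Finset.sum_singleton,
    Nat.reduceAdd, h1, h2, h3, Fintype.card_sum, Fintype.card_fin, Fintype.card_unit]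
  push_cast
  congr 2 <;> ring

/-- The $χ^+$-chromatic mean and variance of the Mycielskian of $K_{a,b}$. -/
theorem chi_plus_chromatic_parameters_mycielskian_completeBipartite
    (a b n : ℕ) (hb : 1 ≤ b) (hab : b < a) (hn : n = a + b) :
    ∃ c : ((Fin a ⊕ Fin b) ⊕ (Fin a ⊕ Fin b) ⊕ Unit) → ℕ,
      (∀ v, c v ∈ Finset.Icc 1 3) ∧
      (∀ x y, (mycielskian (completeBipartiteG a b)).Adj x y → c x ≠ c y) ∧
      colMean c 3 = (6 * (a : ℚ) + 4 * (b : ℚ) + 1) / (2 * (n : ℚ) + 1) ∧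
      colMean c 3 = 2 + (2 * (a : ℚ) - 1) / (2 * (a : ℚ) + 2 * (b : ℚ) + 1) ∧
      colVar c 3 = (16 * (a : ℚ) ^ 2 + 4 * (b : ℚ) ^ 2 + 8 * (a : ℚ) ^ 2 * (b : ℚ)
          + 8 * (a : ℚ) * (b : ℚ) ^ 2 + 24 * (a : ℚ) * (b : ℚ) + 8 * (a : ℚ) + 2 * (b : ℚ))
        / (2 * (n : ℚ) + 1) ^ 3 := by
  subst hn
  have h : (2 * (a : ℚ) + 2 * b + 1) ≠ 0 := by positivity
  have hn : 2 * ((a + b : ℕ) : ℚ) + 1 = 2 * a + 2 * b + 1 := by push_cast; ring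
  refine ⟨bipartiteMycielskianColouring a b, bipartiteMycielskianColouring_mem_Icc a b,
    bipartiteMycielskianColouring_proper a b, ?_, ?_, ?_⟩
  · rw [colMean_bipartiteMycielskianColouring, hn]
  · rw [colMean_bipartiteMycielskianColouring]
    field_simp
    ring
  · rw [colVar_bipartiteMycielskianColouring, hn]
    field_simp
    ring
end

section
/- For every integer n ≥ 2, there exists a proper colouring of the Mycielskian μ(F_{n+1}) of the friendship graph F_{n+1} using the four colours 1, 2, 3, 4 whose colouring mean equals (13n+16)/(4n+6) when n is even and (13n+17)/(4n+6) when n is odd, and whose colouring variance equals (11n²+62n+56)/(4n+6)² when n is even and (11n²+56n+53)/(4n+6)² when n is odd. -/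
open Finset

/-- The friendship graph $F_{n+1}$ (as defined in the paper): the path $P_n$
on `Fin n` together with a central vertex `Sum.inr ()` adjacent to all path
vertices. -/
def friendshipG (n : ℕ) : SimpleGraph (Fin n ⊕ Unit) :=
  SimpleGraph.fromRel (fun x y =>
    match x, y with
    | Sum.inl i, Sum.inl j => (i : ℕ) + 1 = (j : ℕ)
    | Sum.inl _, Sum.inr _ => True
    | _, _ => False)

theorem sum_range_two_mul_alternating (g : ℕ → ℚ) (m : ℕ) :
    ∑ i ∈ Finset.range (2 * m), g (if Even i then 3 else 2) = m * (g 3 + g 2) := by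
  induction m with
  | zero => simp
  | succ m ih =>
    rw [mul_add, mul_one, Finset.sum_range_succ, Finset.sum_range_succ, ih]
    simp
    ring

/-- The colouring of the Mycielskian of `F_{n+1}`: the path alternates between `3` and `2`, its
centre gets `1`, all shadows get `4`, and the apex gets `3`. -/
def mycielskianFriendshipColouring (n : ℕ) : (Fin n ⊕ Unit) ⊕ (Fin n ⊕ Unit) ⊕ Unit → ℕ
  | Sum.inl (Sum.inl i) => if Even (i : ℕ) then 3 else 2
  | Sum.inl (Sum.inr _) => 1
  | Sum.inr (Sum.inl _) => 4
  | Sum.inr (Sum.inr _) => 3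

theorem mycielskianFriendshipColouring_mem_Icc (n : ℕ)
    (v : (Fin n ⊕ Unit) ⊕ (Fin n ⊕ Unit) ⊕ Unit) :
    mycielskianFriendshipColouring n v ∈ Finset.Icc 1 4 := by
  rcases v with (i | _) | _ | _ <;> simp [mycielskianFriendshipColouring]
  split_ifs <;> simp

theorem mycielskianFriendshipColouring_ne_of_adj (n : ℕ)
    {x y : (Fin n ⊕ Unit) ⊕ (Fin n ⊕ Unit) ⊕ Unit}
    (h : (mycielskian (friendshipG n)).Adj x y) :
    mycielskianFriendshipColouring n x ≠ mycielskianFriendshipColouring n y := by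
  rcases x with (i | _) | (i | _) | _ <;> rcases y with (j | _) | (j | _) | _ <;>
    simp [mycielskian, friendshipG, mycielskianFriendshipColouring] at h ⊢ <;>
    grind

theorem sum_mycielskianFriendshipColouring (n : ℕ) (f : ℕ → ℚ) :
    ∑ v, f (mycielskianFriendshipColouring n v) =
      ∑ i ∈ Finset.range n, f (if Even i then 3 else 2) + f 1 + (n + 1) * f 4 + f 3 := by
  rw [← Fin.sum_univ_eq_sum_range fun i => f (if Even i then 3 else 2)]
  simp [mycielskianFriendshipColouring]
  ring

/-- The $χ^+$-chromatic mean and variance of the Mycielskian of the friendship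
graph $F_{n+1}$. -/
theorem chi_plus_chromatic_parameters_mycielskian_friendship (n : ℕ) (hn : 2 ≤ n) :
    ∃ c : ((Fin n ⊕ Unit) ⊕ (Fin n ⊕ Unit) ⊕ Unit) → ℕ,
      (∀ v, c v ∈ Finset.Icc 1 4) ∧
      (∀ x y, (mycielskian (friendshipG n)).Adj x y → c x ≠ c y) ∧
      (Even n →
        colMean c 4 = (13 * (n : ℚ) + 16) / (4 * (n : ℚ) + 6) ∧
        colVar c 4 = (11 * (n : ℚ) ^ 2 + 62 * (n : ℚ) + 56) / (4 * (n : ℚ) + 6) ^ 2) ∧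
      (Odd n →
        colMean c 4 = (13 * (n : ℚ) + 17) / (4 * (n : ℚ) + 6) ∧
        colVar c 4 = (11 * (n : ℚ) ^ 2 + 56 * (n : ℚ) + 53) / (4 * (n : ℚ) + 6) ^ 2) := by
  have hmem := mycielskianFriendshipColouring_mem_Icc n
  have hcard : (Fintype.card ((Fin n ⊕ Unit) ⊕ (Fin n ⊕ Unit) ⊕ Unit) : ℚ) = 2 * n + 3 := by
    simp
    ring
  refine ⟨mycielskianFriendshipColouring n, hmem,
    fun x y => mycielskianFriendshipColouring_ne_of_adj n, ?_, ?_⟩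
  all_goals
    rintro ⟨m, rfl⟩
    rw [colVar, colMean, sum_mul_colClass _ 4 hmem fun i => (i : ℚ),
      sum_mul_colClass _ 4 hmem fun i => (i : ℚ) ^ 2, sum_mycielskianFriendshipColouring,
      sum_mycielskianFriendshipColouring _ fun i => (i : ℚ) ^ 2, hcard]
  · rw [← two_mul, sum_range_two_mul_alternating fun i => (i : ℚ),
      sum_range_two_mul_alternating fun i => (i : ℚ) ^ 2]
    push_cast
    constructor <;> field_simp <;> ring
  · rw [Finset.sum_range_succ, Finset.sum_range_succ,
      sum_range_two_mul_alternating fun i => (i : ℚ),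
      sum_range_two_mul_alternating fun i => (i : ℚ) ^ 2, if_pos (even_two_mul m)]
    push_cast
    constructor <;> field_simp <;> ring
end
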